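/- Let n be an integer with n ≥ 3, let J ⊂ (0, ∞) be a nondegenerate interval, and let f : J → J be a continuous function satisfying f^n(x) = [f(x)]^n / x^{n−1} for every x ∈ J. Then: (i) if J is bounded and 0 ∉ cl J, then f(x) = x for every x ∈ J; (ii) if J is bounded and 0 ∈ cl J, then there exists c ∈ (0, 1] such that f(x) = c·x for every x ∈ J; (iii) if J is unbounded and 0 ∉ cl J, then there exists c ∈ [1, ∞) such that f(x) = c·x for every x ∈ J; (iv) if J = (0, ∞) and n is even, then there exists c ∈ (0, ∞) such that f(x) = c·x for every x ∈ (0, ∞); (v) if J = (0, ∞) and n is odd, then there exists c ∈ (0, ∞) such that either f(x) = c·x for every x ∈ (0, ∞) or f(x) = c·x^{r₀} for every x ∈ (0, ∞), where r₀ is the unique negative real root of the polynomial r^n − n·r + n − 1. -/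

import Mathlib

namespace Boros

/-- conserved quantity -/
lemma q_const (x : ℕ → ℝ) (m : ℕ)
    (hrec : ∀ k, x (k + m + 1) = (m + 1) * x (k + 1) - m * x k) (k : ℕ) :
    ∑ j ∈ Finset.range m, x (k + 1 + j) - m * x k =
      ∑ j ∈ Finset.range m, x (0 + 1 + j) - m * x 0 := by
  induction k with
  | zero => rfl
  | succ k ih =>
    rw [← ih]
    have h1 := Finset.sum_range_succ (fun j => x (k + 1 + j)) m
    have h2 := Finset.sum_range_succ' (fun j => x (k + 1 + j)) m
    have h3 : ∀ j, x (k + 1 + (j + 1)) = x (k + 1 + 1 + j) := fun j => by congr 1; ring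
    simp only [h3] at h2
    have h4 : x (k + 1 + m) = x (k + m + 1) := by congr 1; ring
    have := hrec k
    simp only [add_zero] at h2
    rw [h4] at h1
    linarith

lemma q_bounds (x : ℕ → ℝ) (m : ℕ) (hx : Monotone x)
    (hrec : ∀ k, x (k + m + 1) = (m + 1) * x (k + 1) - m * x k) (k : ℕ) :
    m * (x (k + 1) - x k) ≤ ∑ j ∈ Finset.range m, x (k + 1 + j) - m * x k ∧
    ∑ j ∈ Finset.range m, x (k + 1 + j) - m * x k ≤ m * (m + 1) * (x (k + 1) - x k) := by
  constructor
  · have : ∑ j ∈ Finset.range m, x (k + 1) ≤ ∑ j ∈ Finset.range m, x (k + 1 + j) :=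
      Finset.sum_le_sum fun j _ => hx (by omega)
    simp at this
    linarith
  · have : ∑ j ∈ Finset.range m, x (k + 1 + j) ≤ ∑ j ∈ Finset.range m, x (k + m + 1) :=
      Finset.sum_le_sum fun j hj => hx (by simp at hj; omega)
    simp only [Finset.sum_const, Finset.card_range, nsmul_eq_mul, hrec] at this
    linarith

lemma mono_seq (x : ℕ → ℝ) (m : ℕ) (hm : 1 ≤ m) (hx : Monotone x)
    (hrec : ∀ k, x (k + m + 1) = (m + 1) * x (k + 1) - m * x k) :
    ∃ c, ∀ k, x (k + 1) - x k = c := by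
  have hbb : BddBelow (Set.range fun k => x (k + 1) - x k) :=
    ⟨0, by rintro _ ⟨k, rfl⟩; exact sub_nonneg.2 (hx (Nat.le_succ k))⟩
  set c := ⨅ k, (x (k + 1) - x k) with hc
  have hle : ∀ k, c ≤ x (k + 1) - x k := fun k => ciInf_le hbb k
  have hm' : (1 : ℝ) ≤ m := by exact_mod_cast hm
  refine ⟨c, fun k => ?_⟩
  let w : ℕ → ℝ := fun k => x k - c * k
  have hw : Monotone w := monotone_nat_of_le_succ fun k => by
    have := hle k
    simp only [w]; push_cast; linarith
  have hwr : ∀ k, w (k + m + 1) = (m + 1) * w (k + 1) - m * w k := fun k => by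
    simp only [w, hrec]; push_cast; ring
  have hq := q_const w m hwr
  set q := ∑ j ∈ Finset.range m, w (0 + 1 + j) - m * w 0
  have hd : ∀ k, w (k + 1) - w k = x (k + 1) - x k - c := fun k => by
    simp only [w]; push_cast; ring
  have hq0 : q ≤ 0 := by
    by_contra! h
    have hpos : (0 : ℝ) < m * (m + 1) := by positivity
    obtain ⟨i, hi⟩ := exists_lt_of_ciInf_lt (f := fun k => x (k + 1) - x k)
      (a := c + q / (m * (m + 1))) (by
        rw [← hc]; have := div_pos h hpos; linarith)
    have h1 := (q_bounds w m hw hwr i).2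
    rw [hq, hd] at h1
    have : x (i + 1) - x i - c < q / (m * (m + 1)) := by linarith
    rw [lt_div_iff₀ hpos] at this
    linarith
  have h1 := (q_bounds w m hw hwr k).1
  rw [hq, hd] at h1
  have := hle k
  nlinarith

lemma anti_seq (x : ℕ → ℝ) (m : ℕ) (hm : 1 ≤ m) (hx : Antitone x)
    (hrec : ∀ k, x (k + m + 1) = (m + 1) * x (k + 1) - m * x k) :
    ∃ c, ∀ k, x (k + 1) - x k = c := by
  obtain ⟨c, hc⟩ := mono_seq (fun k => - x k) m hm (fun a b h => neg_le_neg (hx h))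
    (fun k => by simp only [hrec]; ring)
  exact ⟨-c, fun k => by have := hc k; linarith⟩

lemma harnack (a : ℤ → ℝ) (m : ℕ) (α β : ℝ) (hα : 0 < α) (hβ : 0 < β)
    (hab : α + β = 1) (ha : ∀ k, 0 < a k)
    (hrec : ∀ k, a (k + m + 1) = α * a (k + 1) + β * a k) (k : ℤ) : a (k + 1) = a k := by
  have hbb : BddBelow (Set.range a) := ⟨0, by rintro _ ⟨k, rfl⟩; exact (ha k).le⟩
  set c := ⨅ k, a k with hc
  let b : ℤ → ℝ := fun k => a k - c
  have hb : ∀ k, 0 ≤ b k := fun k => sub_nonneg.2 (ciInf_le hbb k)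
  have hbr : ∀ k, b (k + m + 1) = α * b (k + 1) + β * b k := fun k => by
    simp only [b, hrec]; linear_combination c * hab
  -- invariants
  let q : ℤ → ℝ := fun k => β * b k + ∑ j ∈ Finset.range m, b (k + 1 + j)
  have hqs : ∀ k, q (k + 1) = q k := fun k => by
    simp only [q]
    have h1 := Finset.sum_range_succ (fun j : ℕ => b (k + 1 + j)) m
    have h2 := Finset.sum_range_succ' (fun j : ℕ => b (k + 1 + j)) m
    have h3 : ∀ j : ℕ, b (k + 1 + ((j + 1 : ℕ) : ℤ)) = b (k + 1 + 1 + j) := fun j => by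
      congr 1; push_cast; ring
    simp only [h3] at h2
    have h4 : b (k + 1 + m) = b (k + m + 1) := by congr 1; ring
    have := hbr k
    simp only [Nat.cast_zero, add_zero] at h2
    rw [h4] at h1
    have : b (k + 1) = α * b (k + 1) + β * b (k + 1) := by rw [← add_mul, hab, one_mul]
    linarith
  have hqc : ∀ k, q k = q 0 := fun k => by
    induction k using Int.induction_on with
    | zero => rfl
    | succ i ih => rw [hqs, ih]
    | pred i ih => rw [← ih, ← hqs (-(i : ℤ) - 1)]; congr 1; ring
  set μ := min α β with hμ
  have hμ0 : 0 < μ := lt_min hα hβ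
  have s1 : ∀ k, μ * b k ≤ b (k + (m + 1)) := fun k => by
    have h := hbr k
    rw [add_assoc] at h; rw [h]
    have := mul_le_mul_of_nonneg_right (min_le_right α β) (hb k)
    have := mul_nonneg hα.le (hb (k + 1))
    linarith
  have s2 : ∀ k, μ * b k ≤ b (k + m) := fun k => by
    have h := hbr (k - 1)
    have e1 : k - 1 + m + 1 = k + m := by ring
    have e2 : k - 1 + 1 = k := by ring
    rw [e1, e2] at h; rw [h]
    have := mul_le_mul_of_nonneg_right (min_le_left α β) (hb k)
    have := mul_nonneg hβ.le (hb (k - 1))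
    linarith
  have t1 : ∀ (p : ℕ) k, μ ^ p * b k ≤ b (k + p * (m + 1)) := fun p => by
    induction p with
    | zero => simp
    | succ p ih =>
      intro k
      have h := s1 (k + p * (m + 1))
      have h' := mul_le_mul_of_nonneg_left (ih k) hμ0.le
      have e : k + p * (m + 1) + (m + 1) = k + ((p + 1 : ℕ) : ℤ) * (m + 1) := by push_cast; ring
      rw [e] at h
      rw [pow_succ']; linarith
  have t2 : ∀ (p : ℕ) k, μ ^ p * b k ≤ b (k + p * m) := fun p => by
    induction p with
    | zero => simp
    | succ p ih =>
      intro k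
      have h := s2 (k + p * m)
      have h' := mul_le_mul_of_nonneg_left (ih k) hμ0.le
      have e : k + p * m + m = k + ((p + 1 : ℕ) : ℤ) * m := by push_cast; ring
      rw [e] at h
      rw [pow_succ']; linarith
  have t3 : ∀ (i : ℕ) k, i ≤ m → μ ^ m * b (k + i) ≤ b (k + m * (m + 1)) := fun i k hi => by
    obtain ⟨p, rfl⟩ := Nat.exists_eq_add_of_le hi
    have h := t1 p (k + i)
    have h' := t2 i (k + i + p * ((i + p : ℕ) + 1))
    have e : k + i + p * ((i + p : ℕ) + 1) + i * ((i + p : ℕ) : ℤ)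
      = k + ((i + p : ℕ) : ℤ) * ((i + p : ℕ) + 1) := by push_cast; ring
    rw [e] at h'
    refine le_trans ?_ h'
    rw [pow_add, mul_assoc]
    exact mul_le_mul_of_nonneg_left h (pow_nonneg hμ0.le _)
  have hδ : 0 < μ ^ m := pow_pos hμ0 m
  have t4 : ∀ k, μ ^ m * q 0 ≤ (m + 1) * b k := fun k => by
    rw [← hqc (k - m * (m + 1))]
    simp only [q]
    set l := k - m * (m + 1) with hl
    have hk : l + m * (m + 1) = k := by rw [hl]; ring
    have h0 := t3 0 l (Nat.zero_le _)
    rw [hk] at h0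
    simp only [Nat.cast_zero, add_zero] at h0
    have h1 : ∑ j ∈ Finset.range m, μ ^ m * b (l + 1 + j) ≤ ∑ j ∈ Finset.range m, b k := by
      refine Finset.sum_le_sum fun j hj => ?_
      have := t3 (j + 1) l (by simp at hj; omega)
      rw [hk] at this
      have e : l + 1 + (j : ℤ) = l + ((j + 1 : ℕ) : ℤ) := by push_cast; ring
      rw [e]; exact this
    rw [← Finset.mul_sum] at h1
    simp only [Finset.sum_const, Finset.card_range, nsmul_eq_mul] at h1
    have h2 : μ ^ m * (β * b l) ≤ μ ^ m * b l := by
      apply mul_le_mul_of_nonneg_left _ hδ.le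
      have := hb l
      nlinarith
    rw [mul_add]; linarith
  have hq0 : q 0 ≤ 0 := by
    by_contra! h
    have hp : 0 < μ ^ m * q 0 / (m + 1) := by positivity
    obtain ⟨i, hi⟩ := exists_lt_of_ciInf_lt (f := a) (a := c + μ ^ m * q 0 / (m + 1)) (by
      rw [← hc]; linarith)
    have : b i < μ ^ m * q 0 / (m + 1) := by simp only [b]; linarith
    rw [lt_div_iff₀ (by positivity)] at this
    have := t4 i
    linarith
  have hz : ∀ k, b k = 0 := fun k => by
    have h1 := hqc k
    simp only [q] at h1 hq0
    have h2 : 0 ≤ ∑ j ∈ Finset.range m, b (k + 1 + j) := Finset.sum_nonneg fun j _ => hb _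
    have := hb k
    have h3 : β * b k ≤ 0 := by linarith
    have : b k ≤ 0 := by
      by_contra! h
      have := mul_pos hβ h
      linarith
    linarith
  have h1 := hz k
  have h2 := hz (k + 1)
  simp only [b] at h1 h2
  linarith

lemma dichotomy (I : Set ℝ) (hI : I.OrdConnected) (g : ℝ → ℝ) (hc : ContinuousOn g I)
    (hi : Set.InjOn g I) : StrictMonoOn g I ∨ StrictAntiOn g I := by
  by_contra! h
  obtain ⟨h1, h2⟩ := h
  simp only [StrictMonoOn, StrictAntiOn, not_forall, not_lt] at h1 h2
  obtain ⟨u, hu, v, hv, huv, h1⟩ := h1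
  obtain ⟨s, hs, t, ht, hst, h2⟩ := h2
  have hsub : Set.Icc (min u s) (max v t) ⊆ I := by
    apply hI.out
    · rcases min_choice u s with h | h <;> rw [h] <;> assumption
    · rcases max_choice v t with h | h <;> rw [h] <;> assumption
  have mu : u ∈ Set.Icc (min u s) (max v t) := ⟨min_le_left _ _, huv.le.trans (le_max_left _ _)⟩
  have mv : v ∈ Set.Icc (min u s) (max v t) := ⟨(min_le_left _ _).trans huv.le, le_max_left _ _⟩
  have ms : s ∈ Set.Icc (min u s) (max v t) := ⟨min_le_right _ _, hst.le.trans (le_max_right _ _)⟩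
  have mt : t ∈ Set.Icc (min u s) (max v t) := ⟨(min_le_right _ _).trans hst.le, le_max_right _ _⟩
  rcases ContinuousOn.strictMonoOn_of_injOn_Icc' (mu.1.trans mu.2) (hc.mono hsub) (hi.mono hsub)
    with h | h
  · exact absurd (h mu mv huv) (not_lt.2 h1)
  · exact absurd (h ms mt hst) (not_lt.2 h2)

section
variable (m : ℕ) (I : Set ℝ) (g : ℝ → ℝ)

lemma orbit_rec (hg : Set.MapsTo g I I)
    (heq : ∀ x ∈ I, g^[m + 1] x = (m + 1) * g x - m * x) (x : ℝ) (hx : x ∈ I) (k : ℕ) :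
    g^[k + m + 1] x = (m + 1) * g^[k + 1] x - m * g^[k] x := by
  have := heq _ (hg.iterate k hx)
  rw [← Function.iterate_add_apply, ← Function.iterate_succ_apply' g k] at this
  rw [← this]; congr 1; ring_nf

lemma inc_arith (hm : 1 ≤ m) (hg : Set.MapsTo g I I)
    (heq : ∀ x ∈ I, g^[m + 1] x = (m + 1) * g x - m * x) (hmono : StrictMonoOn g I)
    (x : ℝ) (hx : x ∈ I) (k : ℕ) :
    g (g^[k] x) - g^[k] x = g x - x ∧ g^[k] x = x + k * (g x - x) := by
  have hs : Monotone (fun k => g^[k] x) ∨ Antitone (fun k => g^[k] x) := by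
    rcases le_total x (g x) with h | h
    · left
      refine monotone_nat_of_le_succ fun k => ?_
      induction k with
      | zero => simpa using h
      | succ k ih =>
        rw [Function.iterate_succ_apply', Function.iterate_succ_apply' g (k + 1)]
        exact hmono.monotoneOn (hg.iterate _ hx) (hg.iterate _ hx) ih
    · right
      refine antitone_nat_of_succ_le fun k => ?_
      induction k with
      | zero => simpa using h
      | succ k ih =>
        rw [Function.iterate_succ_apply' g k, Function.iterate_succ_apply' g (k + 1)]
        exact hmono.monotoneOn (hg.iterate _ hx) (hg.iterate _ hx) ih
  have : ∃ c, ∀ k, g^[k + 1] x - g^[k] x = c := by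
    rcases hs with h | h
    · exact mono_seq (fun k => g^[k] x) m hm h (orbit_rec m I g hg heq x hx)
    · exact anti_seq (fun k => g^[k] x) m hm h (orbit_rec m I g hg heq x hx)
  obtain ⟨c, hc⟩ := this
  have h0 : g x - x = c := by simpa using hc 0
  rw [h0]
  refine ⟨by rw [← Function.iterate_succ_apply' g]; exact hc k, ?_⟩
  induction k with
  | zero => simp
  | succ k ih =>
    have := hc k
    push_cast; linarith

lemma inc_case (hm : 1 ≤ m) (hI : I.OrdConnected) (hg : Set.MapsTo g I I)
    (hc : ContinuousOn g I)
    (heq : ∀ x ∈ I, g^[m + 1] x = (m + 1) * g x - m * x) (hmono : StrictMonoOn g I) :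
    ∀ x ∈ I, ∀ y ∈ I, g x - x = g y - y := by
  have key := inc_arith m I g hm hg heq hmono
  have itmono : ∀ k : ℕ, ∀ x ∈ I, ∀ y ∈ I, x ≤ y → g^[k] x ≤ g^[k] y := fun k x hx y hy h => by
    induction k with
    | zero => simpa using h
    | succ k ih =>
      rw [Function.iterate_succ_apply', Function.iterate_succ_apply']
      exact hmono.monotoneOn (hg.iterate _ hx) (hg.iterate _ hy) ih
  have hD : ∀ x ∈ I, ∀ y ∈ I, x ≤ y → g x - x ≤ g y - y := fun x hx y hy h => by
    by_contra! hlt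
    obtain ⟨k, hk⟩ := exists_nat_gt ((y - x) / ((g x - x) - (g y - y)))
    rw [div_lt_iff₀ (by linarith)] at hk
    have h1 := itmono k x hx y hy h
    rw [(key x hx k).2, (key y hy k).2] at h1
    linarith
  have hneg : ∀ x ∈ I, ∀ y ∈ I, y ≤ x → g x - x < 0 → g y - y = g x - x :=
    fun x hx y hy h hlt => by
    obtain ⟨k, hk⟩ := exists_nat_gt ((x - y) / (-(g x - x)))
    rw [div_lt_iff₀ (by linarith)] at hk
    obtain ⟨h1, h2⟩ := key x hx k
    have h3 := hD _ (hg.iterate k hx) y hy (by rw [h2]; linarith)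
    have := hD y hy x hx h
    linarith
  have hpos : ∀ x ∈ I, ∀ y ∈ I, x ≤ y → 0 < g x - x → g y - y = g x - x :=
    fun x hx y hy h hlt => by
    obtain ⟨k, hk⟩ := exists_nat_gt ((y - x) / (g x - x))
    rw [div_lt_iff₀ (by linarith)] at hk
    obtain ⟨h1, h2⟩ := key x hx k
    have h3 := hD y hy _ (hg.iterate k hx) (by rw [h2]; linarith)
    have := hD x hx y hy h
    linarith
  have main : ∀ x ∈ I, ∀ y ∈ I, x ≤ y → g x - x = g y - y := fun x hx y hy h => by
    by_contra hne
    have hlt : g x - x < g y - y := lt_of_le_of_ne (hD x hx y hy h) hne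
    have hsub : Set.Icc x y ⊆ I := hI.out hx hy
    have ivt := intermediate_value_Icc h
      (f := fun z => g z - z) ((hc.mono hsub).sub continuousOn_id)
    by_cases hy0 : 0 < g y - y
    · obtain ⟨v, hv1, hv2⟩ := exists_between (max_lt hlt hy0)
      obtain ⟨z, hz, rfl⟩ := ivt ⟨(le_max_left _ _).trans hv1.le, hv2.le⟩
      have := hpos z (hsub hz) y hy hz.2 ((le_max_right _ _).trans_lt hv1)
      simp only at hv2
      linarith
    · obtain ⟨v, hv1, hv2⟩ := exists_between hlt
      obtain ⟨z, hz, rfl⟩ := ivt ⟨hv1.le, hv2.le⟩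
      simp only at hv1 hv2
      have := hneg z (hsub hz) x hx hz.1 (by linarith)
      linarith
  intro x hx y hy
  rcases le_total x y with h | h
  · exact main x hx y hy h
  · exact (main y hy x hx h).symm

lemma fixed_point (hI : I.OrdConnected) (hg : Set.MapsTo g I I)
    (hc : ContinuousOn g I) (hanti : StrictAntiOn g I) (hne : I.Nonempty) :
    ∃ p ∈ I, g p = p := by
  obtain ⟨x, hx⟩ := hne
  have hsub : Set.uIcc x (g x) ⊆ I := hI.uIcc_subset hx (hg hx)
  have ivt := intermediate_value_uIcc
      (f := fun z => g z - z) ((hc.mono hsub).sub continuousOn_id)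
  have : (0 : ℝ) ∈ Set.uIcc (g x - x) (g (g x) - g x) := by
    rcases le_total x (g x) with h | h
    · have := hanti.antitoneOn hx (hg hx) h
      exact Set.mem_uIcc.2 (Or.inr ⟨by linarith, by linarith⟩)
    · have := hanti.antitoneOn (hg hx) hx h
      exact Set.mem_uIcc.2 (Or.inl ⟨by linarith, by linarith⟩)
  obtain ⟨p, hp, h⟩ := ivt this
  exact ⟨p, hsub hp, by simp only at h; linarith⟩

lemma anti_step (hanti : StrictAntiOn g I) (p : ℝ) (hp : p ∈ I) (hgp : g p = p)
    (u : ℝ) (hu : u ∈ I) (hup : u ≠ p) : (g u - p) * (u - p) < 0 := by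
  rcases lt_or_gt_of_ne hup with h | h
  · have := hanti hu hp h
    rw [hgp] at this
    exact mul_neg_of_pos_of_neg (by linarith) (by linarith)
  · have := hanti hp hu h
    rw [hgp] at this
    exact mul_neg_of_neg_of_pos (by linarith) (by linarith)

lemma dec_pos (hg : Set.MapsTo g I I) (hanti : StrictAntiOn g I) (p : ℝ) (hp : p ∈ I)
    (hgp : g p = p) (x : ℝ) (hx : x ∈ I) (hxp : x ≠ p) (k : ℕ) :
    0 < (-1) ^ k * (g^[k] x - p) * (x - p) := by
  have hx0 : x - p ≠ 0 := sub_ne_zero.2 hxp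
  induction k with
  | zero => simpa using mul_self_pos.2 hx0
  | succ k ih =>
    have hk : g^[k] x ≠ p := by
      intro h
      simp [h] at ih
    have h1 := anti_step I g hanti p hp hgp _ (hg.iterate k hx) hk
    rw [Function.iterate_succ_apply']
    set z := g^[k] x - p
    set z' := g (g^[k] x) - p
    rw [pow_succ]
    have h2 : 0 < (z' * z) * ((-1) * (((-1) ^ k * z * (x - p)))) :=
      mul_pos_of_neg_of_neg h1 (by linarith)
    have h3 : 0 < z ^ 2 := by
      have : z ≠ 0 := sub_ne_zero.2 hk
      positivity
    have h4 : (z' * z) * ((-1) * (((-1) ^ k * z * (x - p))))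
      = z ^ 2 * ((-1) ^ k * -1 * z' * (x - p)) := by ring
    rw [h4] at h2
    exact (pos_iff_pos_of_mul_pos h2).1 h3

lemma dec_rec (hg : Set.MapsTo g I I)
    (heq : ∀ x ∈ I, g^[m + 1] x = (m + 1) * g x - m * x) (p : ℝ) (x : ℝ) (hx : x ∈ I) (k : ℕ) :
    (-1) ^ m * ((-1) ^ (k + m + 1) * (g^[k + m + 1] x - p) * (x - p)) =
      (m + 1) * ((-1) ^ (k + 1) * (g^[k + 1] x - p) * (x - p)) +
      m * ((-1) ^ k * (g^[k] x - p) * (x - p)) := by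
  rw [orbit_rec m I g hg heq x hx k]
  have : ((-1 : ℝ) ^ m) * (-1) ^ m = 1 := by rw [← mul_pow]; simp
  rw [pow_succ, pow_add, pow_succ]
  linear_combination ((-1) ^ k * (-1) * ((m + 1) * g^[k + 1] x - m * g^[k] x - p) * (x - p)) * this

lemma dec_even (hg : Set.MapsTo g I I)
    (heq : ∀ x ∈ I, g^[m + 1] x = (m + 1) * g x - m * x) (hanti : StrictAntiOn g I)
    (p : ℝ) (hp : p ∈ I) (hgp : g p = p) (x : ℝ) (hx : x ∈ I) (hxp : x ≠ p) : Even m := by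
  by_contra h
  rw [Nat.not_even_iff_odd] at h
  have h1 := dec_rec m I g hg heq p x hx 0
  have hpos := dec_pos I g hg hanti p hp hgp x hx hxp
  have a0 := hpos (0 + m + 1)
  have a1 := hpos (0 + 1)
  have a2 := hpos 0
  rw [h.neg_one_pow] at h1
  have : 0 ≤ m * ((-1) ^ 0 * (g^[0] x - p) * (x - p)) := by positivity
  have : 0 < (m + 1) * ((-1) ^ (0 + 1) * (g^[0 + 1] x - p) * (x - p)) := by positivity
  linarith

lemma dec_growth (hm : 1 ≤ m) (hg : Set.MapsTo g I I)
    (heq : ∀ x ∈ I, g^[m + 1] x = (m + 1) * g x - m * x) (hanti : StrictAntiOn g I)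
    (p : ℝ) (hp : p ∈ I) (hgp : g p = p) (x : ℝ) (hx : x ∈ I) (hxp : x ≠ p) (B : ℝ) :
    ∃ u ∈ I, (g u - p) * (x - p) < B := by
  have hev := dec_even m I g hg heq hanti p hp hgp x hx hxp
  have hpos := dec_pos I g hg hanti p hp hgp x hx hxp
  have hrec := dec_rec m I g hg heq p x hx
  set y : ℕ → ℝ := fun k => (-1) ^ k * (g^[k] x - p) * (x - p) with hy
  have hpos : ∀ k, 0 < y k := hpos
  have hrec : ∀ k, y (k + m + 1) = (m + 1) * y (k + 1) + m * y k := fun k => by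
    have := hrec k
    rw [hev.neg_one_pow, one_mul] at this
    exact this
  have hgr : ∀ j : ℕ, ((m : ℝ) + 1) ^ j * y 1 ≤ y (j * m + 1) := fun j => by
    induction j with
    | zero => simp
    | succ j ih =>
      have h := hrec (j * m)
      have e : (j + 1) * m + 1 = j * m + m + 1 := by ring
      rw [e, h, pow_succ']
      have h1 : 0 ≤ m * y (j * m) := mul_nonneg (by positivity) (hpos _).le
      have h2 := mul_le_mul_of_nonneg_left ih (by positivity : (0 : ℝ) ≤ m + 1)
      linarith
  have hm' : (1 : ℝ) ≤ m := by exact_mod_cast hm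
  obtain ⟨j, hj⟩ := pow_unbounded_of_one_lt (-B / y 1) (by linarith : (1 : ℝ) < m + 1)
  rw [div_lt_iff₀ (hpos 1)] at hj
  refine ⟨g^[j * m] x, hg.iterate _ hx, ?_⟩
  have h := hgr j
  have e : y (j * m + 1) = - ((g (g^[j * m] x) - p) * (x - p)) := by
    simp only [hy]
    rw [pow_succ, (hev.mul_left j).neg_one_pow, Function.iterate_succ_apply']
    ring
  rw [e] at h
  linarith

lemma dec_unbdd (hm : 1 ≤ m) (hg : Set.MapsTo g I I)
    (heq : ∀ x ∈ I, g^[m + 1] x = (m + 1) * g x - m * x) (hanti : StrictAntiOn g I)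
    (p : ℝ) (hp : p ∈ I) (hgp : g p = p) (x : ℝ) (hx : x ∈ I) (hxp : x ≠ p) :
    (∀ B, ∃ u ∈ I, B < g u) ∧ (∀ B, ∃ u ∈ I, g u < B) := by
  have gr := dec_growth m I g hm hg heq hanti p hp hgp
  have up : ∀ x ∈ I, x < p → ∀ B, ∃ u ∈ I, B < g u := fun x hx h B => by
    obtain ⟨u, hu, h1⟩ := gr x hx h.ne ((B - p) * (x - p))
    exact ⟨u, hu, by nlinarith⟩
  have dn : ∀ x ∈ I, p < x → ∀ B, ∃ u ∈ I, g u < B := fun x hx h B => by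
    obtain ⟨u, hu, h1⟩ := gr x hx h.ne' ((B - p) * (x - p))
    exact ⟨u, hu, by nlinarith⟩
  rcases lt_or_gt_of_ne hxp with h | h
  · have := hanti hx hp h
    rw [hgp] at this
    exact ⟨up x hx h, dn _ (hg hx) this⟩
  · have := hanti hp hx h
    rw [hgp] at this
    exact ⟨up _ (hg hx) this, dn _ hx h⟩

end

lemma dec_univ (m : ℕ) (g : ℝ → ℝ) (hm : 1 ≤ m) (hc : Continuous g)
    (heq : ∀ x, g^[m + 1] x = (m + 1) * g x - m * x) (hanti : StrictAnti g)
    (r : ℝ) (hr : r < 0) (hroot : r ^ (m + 1) = (m + 1) * r - m) (x : ℝ) :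
    g x = g 0 + r * x := by
  have hmt : Set.MapsTo g Set.univ Set.univ := Set.mapsTo_univ _ _
  have heq' : ∀ x ∈ Set.univ, g^[m + 1] x = (m + 1) * g x - m * x := fun x _ => heq x
  have hao : StrictAntiOn g Set.univ := hanti.strictAntiOn _
  obtain ⟨p, -, hgp⟩ := fixed_point Set.univ g Set.ordConnected_univ hmt hc.continuousOn
    hao Set.univ_nonempty
  obtain ⟨hu1, hu2⟩ := dec_unbdd m Set.univ g hm hmt heq' hao p trivial hgp
    (p + 1) trivial (by simp)
  have hsurj : Function.Surjective g := fun c => by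
    obtain ⟨u, -, hu⟩ := hu1 c
    obtain ⟨v, -, hv⟩ := hu2 c
    exact mem_range_of_exists_le_of_exists_ge hc ⟨v, hv.le⟩ ⟨u, hu.le⟩
  let e : Equiv.Perm ℝ := Equiv.ofBijective g ⟨hanti.injective, hsurj⟩
  have he : ∀ x, e x = g x := fun x => rfl
  have hm' : (1 : ℝ) ≤ m := by exact_mod_cast hm
  have hrn : r ^ (m + 1) < 0 := by rw [hroot]; nlinarith
  have main : ∀ x, g x - p = r * (x - p) := by
    intro x
    by_cases hxp : x = p
    · simp [hxp, hgp]
    have hx0 : x - p ≠ 0 := sub_ne_zero.2 hxp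
    let z : ℤ → ℝ := fun k => (e ^ k) x - p
    let a : ℤ → ℝ := fun k => z k / r ^ k * (x - p)
    have hz1 : ∀ k : ℤ, (e ^ (k + 1)) x = g ((e ^ k) x) := fun k => by
      rw [add_comm, zpow_add, zpow_one, Equiv.Perm.mul_apply, he]
    have hzn : ∀ (j : ℕ) (k : ℤ), (e ^ (k + j)) x = g^[j] ((e ^ k) x) := fun j k => by
      induction j with
      | zero => simp
      | succ j ih =>
        rw [Function.iterate_succ_apply', ← ih, ← hz1]; congr 2; push_cast; ring
    have hrec0 : ∀ k : ℤ, z (k + m + 1) = (m + 1) * z (k + 1) - m * z k := fun k => by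
      have h := hzn (m + 1) k
      rw [heq, ← hz1] at h
      have e1 : k + m + 1 = k + ((m + 1 : ℕ) : ℤ) := by push_cast; ring
      simp only [z]
      rw [e1, h]; ring
    have hst : ∀ k, 0 < a (k + 1) ↔ 0 < a k := fun k => by
      by_cases hk : (e ^ k) x = p
      · have h1 : a k = 0 := by simp [a, z, hk]
        have h2 : a (k + 1) = 0 := by simp only [a, z, hz1, hk, hgp]; simp
        rw [h1, h2]
      · have h1 := anti_step Set.univ g hao p trivial hgp _ trivial hk
        rw [← hz1] at h1
        have h1 : z (k + 1) * z k < 0 := h1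
        have hrk : r ^ k ≠ 0 := zpow_ne_zero _ hr.ne
        have h2 : a (k + 1) * a k = (z (k + 1) * z k) * r⁻¹ * ((x - p) / r ^ k) ^ 2 := by
          simp only [a]
          rw [zpow_add_one₀ hr.ne]
          have := hr.ne
          field_simp
        have h3 : 0 < a (k + 1) * a k := by
          rw [h2]
          apply mul_pos (mul_pos_of_neg_of_neg h1 (inv_lt_zero.2 hr))
          positivity
        exact pos_iff_pos_of_mul_pos h3
    have ha0 : 0 < a 0 := by
      simp only [a, z]
      simpa using mul_self_pos.2 hx0
    have ha : ∀ k, 0 < a k := fun k => by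
      induction k using Int.induction_on with
      | zero => exact ha0
      | succ i ih => exact (hst _).2 ih
      | pred i ih =>
        apply (hst _).1
        rwa [sub_add_cancel]
    have hz := harnack a m ((m + 1) * r / r ^ (m + 1)) (- m / r ^ (m + 1))
      (div_pos_of_neg_of_neg (by nlinarith) hrn) (div_pos_of_neg_of_neg (by linarith) hrn)
      (by rw [← add_div, div_eq_one_iff_eq hrn.ne, hroot]; ring) ha
      (fun k => by
        simp only [a]
        rw [hrec0, zpow_add_one₀ hr.ne, zpow_add₀ hr.ne, zpow_add_one₀ hr.ne, zpow_natCast,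
          pow_succ]
        have := hr.ne
        have hrk : r ^ k ≠ 0 := zpow_ne_zero _ hr.ne
        field_simp
        ring) 0
    simp only [a, z] at hz
    simp only [zero_add, zpow_one, zpow_zero, he, Equiv.Perm.one_apply, div_one] at hz
    have := mul_right_cancel₀ hx0 hz
    rw [div_eq_iff hr.ne] at this
    linarith
  have h1 := main x
  have h2 := main 0
  linarith

lemma inc_sign (I : Set ℝ) (g : ℝ → ℝ) (hg : Set.MapsTo g I I) (d : ℝ)
    (hd : ∀ x ∈ I, g x = x + d) (x : ℝ) (hx : x ∈ I) :
    (BddAbove I → d ≤ 0) ∧ (BddBelow I → 0 ≤ d) := by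
  have hit : ∀ k : ℕ, g^[k] x = x + k * d := fun k => by
    induction k with
    | zero => simp
    | succ k ih =>
      rw [Function.iterate_succ_apply', hd _ (hg.iterate k hx), ih]; push_cast; ring
  constructor
  · rintro ⟨B, hB⟩
    by_contra! h
    obtain ⟨k, hk⟩ := exists_nat_gt ((B - x) / d)
    rw [div_lt_iff₀ h] at hk
    have := hB (hg.iterate k hx)
    rw [hit] at this
    linarith
  · rintro ⟨B, hB⟩
    by_contra! h
    obtain ⟨k, hk⟩ := exists_nat_gt ((x - B) / (-d))
    rw [div_lt_iff₀ (by linarith)] at hk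
    have := hB (hg.iterate k hx)
    rw [hit] at this
    linarith

end Boros


/-- Solution of the generalized Boros problem: continuous solutions `f : J → J` of
`f^n(x) = f(x)^n / x^{n−1}` (`n ≥ 3`) on a nondegenerate interval `J ⊆ (0, ∞)`. -/
theorem generalized_boros_problem
    (n : ℕ) (hn : 3 ≤ n)
    (J : Set ℝ) (hJ : J ⊆ Set.Ioi (0 : ℝ)) (hJI : J.OrdConnected)
    (hne : ∃ a ∈ J, ∃ b ∈ J, a ≠ b)
    (f : ℝ → ℝ) (hf : Set.MapsTo f J J) (hfc : ContinuousOn f J)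
    (heq : ∀ x ∈ J, f^[n] x = (f x) ^ n / x ^ (n - 1)) :
    (Bornology.IsBounded J → (0 : ℝ) ∉ closure J → ∀ x ∈ J, f x = x) ∧
    (Bornology.IsBounded J → (0 : ℝ) ∈ closure J →
      ∃ c ∈ Set.Ioc (0 : ℝ) 1, ∀ x ∈ J, f x = c * x) ∧
    (¬ Bornology.IsBounded J → (0 : ℝ) ∉ closure J →
      ∃ c ∈ Set.Ici (1 : ℝ), ∀ x ∈ J, f x = c * x) ∧
    (J = Set.Ioi (0 : ℝ) → Even n →
      ∃ c ∈ Set.Ioi (0 : ℝ), ∀ x ∈ J, f x = c * x) ∧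
    (J = Set.Ioi (0 : ℝ) → Odd n →
      ∃ c ∈ Set.Ioi (0 : ℝ), (∀ x ∈ J, f x = c * x) ∨
        (∀ r₀ : ℝ, r₀ < 0 → r₀ ^ n - (n : ℝ) * r₀ + (n : ℝ) - 1 = 0 →
          ∀ x ∈ J, f x = c * x ^ r₀)) := by
  obtain ⟨m, rfl⟩ : ∃ m, n = m + 1 := ⟨n - 1, by omega⟩
  have hm : 1 ≤ m := by omega
  simp only [Nat.add_sub_cancel] at heq
  set I : Set ℝ := Real.exp ⁻¹' J with hIdef
  set g : ℝ → ℝ := fun t => Real.log (f (Real.exp t)) with hgdef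
  have hpos : ∀ x ∈ J, 0 < x := fun x hx => hJ hx
  have hlogI : ∀ x ∈ J, Real.log x ∈ I := fun x hx => by
    simp only [hIdef, Set.mem_preimage, Real.exp_log (hpos x hx)]; exact hx
  have heg : ∀ t ∈ I, Real.exp (g t) = f (Real.exp t) := fun t ht =>
    Real.exp_log (hpos _ (hf ht))
  have hg : Set.MapsTo g I I := fun t ht => hlogI _ (hf ht)
  have hI : I.OrdConnected := hJI.preimage_mono Real.exp_monotone
  have hgc : ContinuousOn g I := by
    refine ContinuousOn.log (hfc.comp Real.continuous_exp.continuousOn fun t ht => ht) ?_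
    exact fun t ht => (hpos _ (hf ht)).ne'
  have hit : ∀ (k : ℕ), ∀ t ∈ I, Real.exp (g^[k] t) = f^[k] (Real.exp t) := fun k t ht => by
    induction k with
    | zero => rfl
    | succ k ih =>
      rw [Function.iterate_succ_apply', Function.iterate_succ_apply', ← ih, heg _ (hg.iterate k ht)]
  have hgeq : ∀ t ∈ I, g^[m + 1] t = (m + 1) * g t - m * t := fun t ht => by
    apply Real.exp_injective
    rw [hit _ t ht, heq _ ht, Real.exp_sub, ← heg t ht, ← Real.exp_nat_mul, ← Real.exp_nat_mul]
    push_cast; rfl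
  have hinj : Set.InjOn g I := fun s hs t ht h => by
    have hk : ∀ k : ℕ, g^[k + 1] s = g^[k + 1] t := fun k => by
      rw [Function.iterate_succ_apply, Function.iterate_succ_apply, h]
    have h1 := hk m
    rw [hgeq s hs, hgeq t ht, h] at h1
    have hm' : (1 : ℝ) ≤ m := by exact_mod_cast hm
    have h2 : (m : ℝ) * s = m * t := by linarith
    exact mul_left_cancel₀ (by positivity) h2
  have hfg : ∀ x ∈ J, f x = Real.exp (g (Real.log x)) := fun x hx => by
    rw [heg _ (hlogI x hx), Real.exp_log (hpos x hx)]
  obtain ⟨a, ha, b, hb, hab⟩ := hne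
  have hlab : Real.log a ≠ Real.log b := fun h =>
    hab (Real.log_injOn_pos (hpos a ha) (hpos b hb) h)
  have hba : Bornology.IsBounded J → BddAbove I := fun h => by
    obtain ⟨B, hB⟩ := h.bddAbove
    refine ⟨Real.log B, fun t ht => ?_⟩
    have := hB ht
    rwa [Real.le_log_iff_exp_le ((Real.exp_pos t).trans_le this)]
  have hbb : (0 : ℝ) ∉ closure J → BddBelow I := fun h => by
    rw [Metric.mem_closure_iff] at h
    push Not at h
    obtain ⟨ε, hε, h⟩ := h
    refine ⟨Real.log ε, fun t ht => ?_⟩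
    have := h _ ht
    rw [Real.dist_eq, zero_sub, abs_neg, abs_of_pos (Real.exp_pos t)] at this
    rwa [Real.log_le_iff_le_exp hε]
  rcases Boros.dichotomy I hI g hgc hinj with hmono | hanti
  · have hc := Boros.inc_case m I g hm hI hg hgc hgeq hmono
    set d := g (Real.log a) - Real.log a
    have hd : ∀ t ∈ I, g t = t + d := fun t ht => by
      have := hc t ht _ (hlogI a ha)
      linarith
    have hfd : ∀ x ∈ J, f x = Real.exp d * x := fun x hx => by
      rw [hfg x hx, hd _ (hlogI x hx), Real.exp_add, Real.exp_log (hpos x hx), mul_comm]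
    obtain ⟨s1, s2⟩ := Boros.inc_sign I g hg d hd _ (hlogI a ha)
    refine ⟨fun h1 h2 x hx => ?_, fun h1 h2 => ?_, fun h1 h2 => ?_, fun _ _ => ?_, fun _ _ => ?_⟩
    · have : d = 0 := le_antisymm (s1 (hba h1)) (s2 (hbb h2))
      rw [hfd x hx, this]; simp
    · exact ⟨Real.exp d, ⟨Real.exp_pos d, Real.exp_le_one_iff.2 (s1 (hba h1))⟩, hfd⟩
    · exact ⟨Real.exp d, Real.one_le_exp (s2 (hbb h2)), hfd⟩
    · exact ⟨Real.exp d, Real.exp_pos d, hfd⟩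
    · exact ⟨Real.exp d, Real.exp_pos d, Or.inl hfd⟩
  · obtain ⟨p, hp, hgp⟩ := Boros.fixed_point I g hI hg hgc hanti ⟨_, hlogI a ha⟩
    obtain ⟨x, hx, hxp⟩ : ∃ x ∈ I, x ≠ p := by
      by_cases h : Real.log a = p
      · exact ⟨_, hlogI b hb, fun h' => hlab (h.trans h'.symm)⟩
      · exact ⟨_, hlogI a ha, h⟩
    have hev := Boros.dec_even m I g hg hgeq hanti p hp hgp x hx hxp
    obtain ⟨u1, u2⟩ := Boros.dec_unbdd m I g hm hg hgeq hanti p hp hgp x hx hxp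
    have nA : ¬ BddAbove I := by
      rintro ⟨B, hB⟩
      obtain ⟨u, hu, h⟩ := u1 B
      exact absurd (hB (hg hu)) (not_le.2 h)
    have nB : ¬ BddBelow I := by
      rintro ⟨B, hB⟩
      obtain ⟨u, hu, h⟩ := u2 B
      exact absurd (hB (hg hu)) (not_le.2 h)
    refine ⟨fun h1 _ => absurd (hba h1) nA, fun h1 _ => absurd (hba h1) nA,
      fun _ h2 => absurd (hbb h2) nB, fun _ h => ?_, fun hJe _ => ?_⟩
    · exact absurd hev (Nat.even_add_one.1 h)
    · have hIu : I = Set.univ := by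
        ext t
        simp only [hIdef, hJe, Set.mem_preimage, Set.mem_Ioi, Set.mem_univ, iff_true]
        exact Real.exp_pos t
      refine ⟨Real.exp (g 0), Real.exp_pos _, Or.inr fun r hr hroot x hx => ?_⟩
      have h := Boros.dec_univ m g hm (by rwa [hIu, continuousOn_univ] at hgc)
        (fun t => hgeq t (by rw [hIu]; trivial)) (by rwa [hIu, strictAntiOn_univ] at hanti)
        r hr (by push_cast at hroot; linarith) (Real.log x)
      rw [hfg x hx, h, Real.exp_add, Real.rpow_def_of_pos (hpos x hx), mul_comm r]
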